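/- Let G be a finite group of nilpotency class at most two and let c be an element of the center of G. Then for all integers i, j and every f ∈ G, the permutation x^j·σ_c·x^{−j} of G^ω commutes with x^i·σ_f·x^{−i}; consequently x^j·σ_c·x^{−j} is central in the subgroup N generated by {x^i·σ_g·x^{−i} : i ∈ ℤ, g ∈ G}. -/

import Mathlib

/-- The Cayley machine transformation of a group `G` at state `g`, acting on right-infinite
words `w : ℕ → G`: `(cayley g w) n = g * w 0 * w 1 * ⋯ * w n`. -/
def cayley {G : Type*} [Group G] (g : G) : Equiv.Perm (ℕ → G) where
  toFun w n := g * ((List.range (n + 1)).map w).prod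
  invFun v n :=
    match n with
    | 0 => g⁻¹ * v 0
    | m + 1 => (v m)⁻¹ * v (m + 1)
  left_inv w := by
    funext n
    match n with
    | 0 => simp [List.range_succ]
    | m + 1 => simp [List.range_succ, mul_assoc]
  right_inv v := by
    funext n
    induction n with
    | zero => simp [List.range_succ]
    | succ m ih =>
      beta_reduce at ih ⊢
      rw [List.range_succ, List.map_append, List.prod_append, ← mul_assoc, ih]
      simp [mul_assoc]

/-- The permutation `x = C₁⁻¹`, the inverse of the Cayley machine transformation at the
identity state.  It satisfies `(x w) 0 = w 0` and `(x w) n = (w (n-1))⁻¹ * w n` for `n ≥ 1`. -/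
def xPerm (G : Type*) [Group G] : Equiv.Perm (ℕ → G) := (cayley (1 : G))⁻¹

/-- The permutation `σ_g = x * C_g`, given by `(σ_g w) 0 = g * w 0` and `(σ_g w) n = w n`
for `n ≥ 1`.  The map `g ↦ σ_g` identifies `G` with a subgroup of the automata group. -/
def sigma' {G : Type*} [Group G] (g : G) : Equiv.Perm (ℕ → G) := xPerm G * cayley g

/-- Pointwise left multiplication of words over `G` by a word over the center of `G`. -/
def centralTranslation {G : Type*} [Group G] (z : ℕ → Subgroup.center G) :
    Equiv.Perm (ℕ → G) :=
  Equiv.mulLeft fun n => (z n : G)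

theorem centralTranslation_apply {G : Type*} [Group G] (z : ℕ → Subgroup.center G)
    (w : ℕ → G) (n : ℕ) : centralTranslation z w n = z n * w n := rfl

theorem xPerm_apply_zero {G : Type*} [Group G] (w : ℕ → G) : xPerm G w 0 = w 0 := by
  change (1 : G)⁻¹ * w 0 = w 0
  simp

theorem xPerm_apply_succ {G : Type*} [Group G] (w : ℕ → G) (n : ℕ) :
    xPerm G w (n + 1) = (w n)⁻¹ * w (n + 1) := rfl

theorem sigma'_apply_zero {G : Type*} [Group G] (g : G) (w : ℕ → G) :
    sigma' g w 0 = g * w 0 := by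
  simp [sigma', xPerm_apply_zero, cayley, List.range_succ]

theorem sigma'_apply_succ {G : Type*} [Group G] (g : G) (w : ℕ → G) (n : ℕ) :
    sigma' g w (n + 1) = w (n + 1) := by
  rw [sigma', Equiv.Perm.mul_apply, xPerm_apply_succ]
  simp [cayley, List.range_succ, mul_assoc]

theorem xPerm_mul_centralTranslation {G : Type*} [Group G] (z : ℕ → Subgroup.center G) :
    xPerm G * centralTranslation z =
      centralTranslation (xPerm (Subgroup.center G) z) * xPerm G := by
  ext w n
  cases n with
  | zero => simp [xPerm_apply_zero, centralTranslation_apply]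
  | succ n =>
    have h := Subgroup.mem_center_iff.mp
      (mul_mem (inv_mem (z n).2) (z (n + 1)).2) (w n)⁻¹
    have hz := Subgroup.mem_center_iff.mp (inv_mem (z n).2) (w n)⁻¹
    simp only [Equiv.Perm.mul_apply, xPerm_apply_succ, centralTranslation_apply, mul_inv_rev,
      Subgroup.coe_mul, Subgroup.coe_inv]
    rw [hz, ← mul_assoc, ← mul_assoc, ← h, ← mul_assoc, hz]

theorem xPerm_zpow_conj_centralTranslation {G : Type*} [Group G]
    (z : ℕ → Subgroup.center G) (i : ℤ) :
    xPerm G ^ i * centralTranslation z * (xPerm G ^ i)⁻¹ =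
      centralTranslation ((xPerm (Subgroup.center G) ^ i) z) := by
  rw [mul_inv_eq_iff_eq_mul]
  induction i with
  | zero => simp
  | succ k ih =>
    rw [add_comm, zpow_one_add, zpow_one_add, mul_assoc, ih, ← mul_assoc,
      xPerm_mul_centralTranslation, mul_assoc, Equiv.Perm.mul_apply]
  | pred k ih =>
    have h := xPerm_mul_centralTranslation ((xPerm (Subgroup.center G) ^ (-(k : ℤ) - 1)) z)
    rw [← Equiv.Perm.mul_apply, ← zpow_one_add, add_sub_cancel] at h
    apply mul_left_cancel (a := xPerm G)
    rw [← mul_assoc, ← mul_assoc, ← zpow_one_add, add_sub_cancel, h, mul_assoc, ← zpow_one_add,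
      add_sub_cancel, ih]

theorem sigma'_eq_centralTranslation {G : Type*} [Group G] (c : Subgroup.center G) :
    sigma' (c : G) = centralTranslation (Pi.mulSingle 0 c) := by
  ext w n
  cases n with
  | zero => simp [sigma'_apply_zero, centralTranslation_apply]
  | succ n => simp [sigma'_apply_succ, centralTranslation_apply]

theorem commute_centralTranslation_sigma' {G : Type*} [Group G]
    (z : ℕ → Subgroup.center G) (f : G) : Commute (centralTranslation z) (sigma' f) := by
  ext w n
  cases n with
  | zero =>
    have h := Subgroup.mem_center_iff.mp (z 0).2 f
    simp only [Equiv.Perm.mul_apply, sigma'_apply_zero, centralTranslation_apply]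
    rw [← mul_assoc, ← mul_assoc, h]
  | succ n => simp [sigma'_apply_succ, centralTranslation_apply]

theorem commute_centralTranslation_xPerm_conj {G : Type*} [Group G]
    (z : ℕ → Subgroup.center G) (i : ℤ) (f : G) :
    Commute (centralTranslation z) (xPerm G ^ i * sigma' f * (xPerm G ^ i)⁻¹) := by
  have h := xPerm_zpow_conj_centralTranslation ((xPerm (Subgroup.center G) ^ (-i)) z) i
  rw [← Equiv.Perm.mul_apply, ← zpow_add, add_neg_cancel, zpow_zero,
    Equiv.Perm.one_apply] at h
  rw [← h, Commute.conj_iff]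
  exact commute_centralTranslation_sigma' _ f

/-- Let `G` be a finite group of nilpotency class at most two and `c` a central element of
`G`.  Then for all integers `i, j` and every `f ∈ G`, the permutation `x^j σ_c x^{-j}`
commutes with `x^i σ_f x^{-i}`; consequently `x^j σ_c x^{-j}` is central in the subgroup
`N` generated by `{xⁱ σ_g x⁻ⁱ : i ∈ ℤ, g ∈ G}`. -/
theorem central_conjugates {G : Type*} [Group G] [Finite G]
    (hG : ∀ g h : G, g⁻¹ * h⁻¹ * g * h ∈ Subgroup.center G)
    (c : G) (hc : c ∈ Subgroup.center G) :
    (∀ (i j : ℤ) (f : G),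
      Commute (xPerm G ^ j * sigma' c * (xPerm G ^ j)⁻¹)
        (xPerm G ^ i * sigma' f * (xPerm G ^ i)⁻¹)) ∧
    (∀ (j : ℤ) (γ : Equiv.Perm (ℕ → G)),
      γ ∈ Subgroup.closure
        {p : Equiv.Perm (ℕ → G) |
          ∃ (i : ℤ) (g : G), p = xPerm G ^ i * sigma' g * (xPerm G ^ i)⁻¹} →
      Commute (xPerm G ^ j * sigma' c * (xPerm G ^ j)⁻¹) γ) := by
  have hcomm (i j : ℤ) (f : G) :
      Commute (xPerm G ^ j * sigma' c * (xPerm G ^ j)⁻¹)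
        (xPerm G ^ i * sigma' f * (xPerm G ^ i)⁻¹) := by
    rw [sigma'_eq_centralTranslation ⟨c, hc⟩, xPerm_zpow_conj_centralTranslation]
    exact commute_centralTranslation_xPerm_conj _ i f
  refine ⟨hcomm, fun j γ hγ => ?_⟩
  induction hγ using Subgroup.closure_induction with
  | mem p hp =>
    obtain ⟨i, g, rfl⟩ := hp
    exact hcomm i j g
  | one => exact Commute.one_right _
  | mul p q _ _ hp hq => exact hp.mul_right hq
  | inv p _ hp => exact hp.inv_right
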